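/- arXiv:1805.10976 — 2 statements merged into one kernel-verified Lean document; each statement's English description precedes it below -/
import Mathlib

section
/- (Achievability of the lower bound by a constant residual.) Let λ ∈ ℂ with λ ≠ 0, let h > 0, set μ = λh, let R ∈ ℂ with R ≠ 0, let y₀ ∈ ℂ, and let k be any integer. Define the constant δ = (Log R + 2πik)/μ − 1 and z(t) = y₀·exp(λ(1 + δ)t) for t ∈ [0,h]. Then z(0) = y₀, z(h) = R·y₀, and ż(t) = λ(1 + δ)·z(t) for all t ∈ [0,h]; in particular the constant residual of magnitude |(Log R + 2πik)/μ − 1| takes y₀ to R·y₀. -/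
/-- Achievability of the lower bound by a constant residual.  For any integer `k`,
the constant `δ = (Log R + 2πik)/μ − 1` and the interpolant
`z(t) = y₀·exp(λ(1 + δ)t)` satisfy `z 0 = y₀`, `z h = R·y₀` and
`ż(t) = λ(1 + δ)·z(t)` for all `t`. -/
theorem constant_residual_achieves_bound (lam : ℂ) (hlam : lam ≠ 0)
    (h : ℝ) (hh : 0 < h) (μ : ℂ) (hμ : μ = lam * (h : ℂ))
    (R : ℂ) (hR : R ≠ 0) (y₀ : ℂ) (k : ℤ)
    (δ : ℂ) (hδ : δ = (Complex.log R + 2 * Real.pi * Complex.I * (k : ℂ)) / μ - 1)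
    (z : ℝ → ℂ) (hz : ∀ t : ℝ, z t = y₀ * Complex.exp (lam * (1 + δ) * (t : ℂ))) :
    z 0 = y₀ ∧ z h = R * y₀ ∧
      ∀ t ∈ Set.Icc (0:ℝ) h, HasDerivAt z (lam * (1 + δ) * z t) t := by
  have hh' : (h : ℂ) ≠ 0 := by exact_mod_cast hh.ne'
  have hexponent : lam * (1 + δ) * (h : ℂ)
      = Complex.log R + (k : ℂ) * (2 * Real.pi * Complex.I) := by
    rw [hδ, hμ]
    field_simp
    ring
  refine ⟨by simp [hz], ?_, fun t _ => ?_⟩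
  · rw [hz, hexponent, Complex.exp_add, Complex.exp_log hR,
      Complex.exp_int_mul_two_pi_mul_I, mul_one, mul_comm]
  · have hlin : HasDerivAt (fun s : ℝ => lam * (1 + δ) * (s : ℂ)) (lam * (1 + δ)) t := by
      simpa using (Complex.ofRealCLM.hasDerivAt (x := t)).const_mul (lam * (1 + δ))
    rw [funext hz]
    refine (hlin.cexp.const_mul y₀).congr_deriv ?_
    ring
end

section
/- (Optimal relative backward error, real positive case.) Let λ ∈ ℝ with λ ≠ 0, let h > 0, and let y₀ > 0 and y₁ > 0. Consider all continuously differentiable functions z : [0,h] → ℝ with z(t) > 0 for all t, z(0) = y₀, and z(h) = y₁, with residual δ(t) = ż(t)/(λ·z(t)) − 1. Then the infimum over all such z of sup_{0 ≤ t ≤ h}|δ(t)| equals |ln(y₁/y₀)/(λh) − 1|, and it is attained by z(t) = y₀·exp(ln(y₁/y₀)·t/h), whose residual is the constant ln(y₁/y₀)/(λh) − 1. -/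
/-- A positive interpolant attains its mean logarithmic slope at some interior point. -/
theorem exists_relative_residual_eq {lam h y₀ y₁ : ℝ} (hh : 0 < h) (hy₀ : 0 < y₀) (hy₁ : 0 < y₁)
    {z z' : ℝ → ℝ}
    (hz : ∀ t ∈ Set.Icc (0 : ℝ) h, HasDerivWithinAt z (z' t) (Set.Icc 0 h) t)
    (hpos : ∀ t ∈ Set.Icc (0 : ℝ) h, 0 < z t) (h0 : z 0 = y₀) (h1 : z h = y₁) :
    ∃ c ∈ Set.Icc (0 : ℝ) h,
      z' c / (lam * z c) - 1 = Real.log (y₁ / y₀) / (lam * h) - 1 := by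
  have hlog : ∀ t ∈ Set.Icc (0 : ℝ) h,
      HasDerivWithinAt (fun s => Real.log (z s)) (z' t / z t) (Set.Icc 0 h) t :=
    fun t ht => (hz t ht).log (hpos t ht).ne'
  obtain ⟨c, hc, hslope⟩ := exists_hasDerivAt_eq_slope (fun s => Real.log (z s))
    (fun t => z' t / z t) hh (fun t ht => (hlog t ht).continuousWithinAt)
    (fun t ht => (hlog t (Set.Ioo_subset_Icc_self ht)).hasDerivAt (Icc_mem_nhds ht.1 ht.2))
  refine ⟨c, Set.Ioo_subset_Icc_self hc, ?_⟩
  simp only [h0, h1, sub_zero] at hslope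
  rw [mul_comm lam, mul_comm lam, ← div_div, ← div_div, hslope,
    Real.log_div hy₁.ne' hy₀.ne']

/-- The supremum of the relative residual of a positive interpolant is at least the residual of
the exponential interpolant. -/
theorem abs_le_sSup_relative_residual {lam h y₀ y₁ : ℝ} (hlam : lam ≠ 0) (hh : 0 < h)
    (hy₀ : 0 < y₀) (hy₁ : 0 < y₁) {z z' : ℝ → ℝ}
    (hz : ∀ t ∈ Set.Icc (0 : ℝ) h, HasDerivWithinAt z (z' t) (Set.Icc 0 h) t)
    (hz' : ContinuousOn z' (Set.Icc 0 h))
    (hpos : ∀ t ∈ Set.Icc (0 : ℝ) h, 0 < z t) (h0 : z 0 = y₀) (h1 : z h = y₁) :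
    |Real.log (y₁ / y₀) / (lam * h) - 1| ≤
      sSup ((fun t => |z' t / (lam * z t) - 1|) '' Set.Icc (0 : ℝ) h) := by
  obtain ⟨c, hc, hres⟩ := exists_relative_residual_eq (lam := lam) hh hy₀ hy₁ hz hpos h0 h1
  have hzc : ContinuousOn z (Set.Icc 0 h) := fun t ht => (hz t ht).continuousWithinAt
  have hcont : ContinuousOn (fun t => |z' t / (lam * z t) - 1|) (Set.Icc 0 h) :=
    ((hz'.div (continuousOn_const.mul hzc)
      (fun t ht => mul_ne_zero hlam (hpos t ht).ne')).sub continuousOn_const).abs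
  rw [← hres]
  exact le_csSup (isCompact_Icc.image_of_continuousOn hcont).bddAbove ⟨c, hc, rfl⟩


/-- Optimal relative backward error, real positive case.  Over all continuously
differentiable positive interpolants `z : [0,h] → ℝ` with `z 0 = y₀`, `z h = y₁`
and residual `δ(t) = ż(t)/(λ z(t)) − 1`, the infimum of `sup_{0 ≤ t ≤ h} |δ(t)|`
equals `|ln(y₁/y₀)/(λh) − 1|`, and it is attained by
`z(t) = y₀ · exp(ln(y₁/y₀) · t/h)`, whose residual is the constant
`ln(y₁/y₀)/(λh) − 1`. -/
theorem optimal_relative_backward_error_real (lam h y₀ y₁ : ℝ)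
    (hlam : lam ≠ 0) (hh : 0 < h) (hy₀ : 0 < y₀) (hy₁ : 0 < y₁) :
    sInf {a : ℝ | ∃ z z' : ℝ → ℝ,
        (∀ t ∈ Set.Icc (0:ℝ) h, HasDerivWithinAt z (z' t) (Set.Icc 0 h) t) ∧
        ContinuousOn z' (Set.Icc 0 h) ∧
        (∀ t ∈ Set.Icc (0:ℝ) h, 0 < z t) ∧
        z 0 = y₀ ∧ z h = y₁ ∧
        a = sSup ((fun t => |z' t / (lam * z t) - 1|) '' Set.Icc (0:ℝ) h)}
      = |Real.log (y₁ / y₀) / (lam * h) - 1| ∧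
    -- attainment by the exponential interpolant with constant residual
    (fun t : ℝ => y₀ * Real.exp (Real.log (y₁ / y₀) * t / h)) 0 = y₀ ∧
    (fun t : ℝ => y₀ * Real.exp (Real.log (y₁ / y₀) * t / h)) h = y₁ ∧
    (∀ t ∈ Set.Icc (0:ℝ) h,
      HasDerivWithinAt (fun t : ℝ => y₀ * Real.exp (Real.log (y₁ / y₀) * t / h))
        ((Real.log (y₁ / y₀) / h) *
          (y₀ * Real.exp (Real.log (y₁ / y₀) * t / h))) (Set.Icc 0 h) t) ∧
    (∀ t ∈ Set.Icc (0:ℝ) h,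
      ((Real.log (y₁ / y₀) / h) * (y₀ * Real.exp (Real.log (y₁ / y₀) * t / h))) /
          (lam * (y₀ * Real.exp (Real.log (y₁ / y₀) * t / h))) - 1
        = Real.log (y₁ / y₀) / (lam * h) - 1) ∧
    |Real.log (y₁ / y₀) / (lam * h) - 1| ∈ {a : ℝ | ∃ z z' : ℝ → ℝ,
        (∀ t ∈ Set.Icc (0:ℝ) h, HasDerivWithinAt z (z' t) (Set.Icc 0 h) t) ∧
        ContinuousOn z' (Set.Icc 0 h) ∧
        (∀ t ∈ Set.Icc (0:ℝ) h, 0 < z t) ∧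
        z 0 = y₀ ∧ z h = y₁ ∧
        a = sSup ((fun t => |z' t / (lam * z t) - 1|) '' Set.Icc (0:ℝ) h)} := by
  have hE0 : y₀ * Real.exp (Real.log (y₁ / y₀) * 0 / h) = y₀ := by simp
  have hEh : y₀ * Real.exp (Real.log (y₁ / y₀) * h / h) = y₁ := by
    rw [mul_div_cancel_right₀ _ hh.ne', Real.exp_log (div_pos hy₁ hy₀), mul_div_cancel₀ _ hy₀.ne']
  have hEpos : ∀ t : ℝ, 0 < y₀ * Real.exp (Real.log (y₁ / y₀) * t / h) :=
    fun t => mul_pos hy₀ (Real.exp_pos _)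
  have hEderiv : ∀ t : ℝ,
      HasDerivAt (fun t : ℝ => y₀ * Real.exp (Real.log (y₁ / y₀) * t / h))
        ((Real.log (y₁ / y₀) / h) * (y₀ * Real.exp (Real.log (y₁ / y₀) * t / h))) t := by
    intro t
    refine (((((hasDerivAt_id' t).const_mul (Real.log (y₁ / y₀))).div_const h).exp).const_mul
      y₀).congr_deriv ?_
    ring
  have hEres : ∀ t : ℝ,
      ((Real.log (y₁ / y₀) / h) * (y₀ * Real.exp (Real.log (y₁ / y₀) * t / h))) /
          (lam * (y₀ * Real.exp (Real.log (y₁ / y₀) * t / h))) - 1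
        = Real.log (y₁ / y₀) / (lam * h) - 1 := by
    intro t
    rw [mul_div_mul_right _ _ (hEpos t).ne', div_div, mul_comm h]
  suffices hmem : _ by
    refine ⟨IsLeast.csInf_eq ⟨hmem, ?_⟩, hE0, hEh, fun t _ => (hEderiv t).hasDerivWithinAt,
      fun t _ => hEres t, hmem⟩
    rintro a ⟨z, z', hz, hz', hpos, h0, h1, rfl⟩
    exact abs_le_sSup_relative_residual hlam hh hy₀ hy₁ hz hz' hpos h0 h1
  refine ⟨_, _, fun t _ => (hEderiv t).hasDerivWithinAt, ?_, fun t _ => hEpos t, hE0, hEh, ?_⟩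
  · fun_prop
  · simp only [hEres]
    rw [(Set.nonempty_Icc.2 hh.le).image_const, csSup_singleton]
end
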